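/- For 0 < α < 1 and x ≥ 0, E_α(-x) = ∫₀^∞ e^{-x t} p_α(t) dt where p_α(t) = (1/α) f_α(t^{-1/α}) t^{-1/α-1} is the Pollard density; consequently E_α(-x) is completely monotone on (0,∞). -/

import Mathlib

/-- The one-parameter Mittag-Leffler function `E_α(x) = ∑ x^k / Γ(αk+1)`. -/
noncomputable def mittagLeffler (α x : ℝ) : ℝ :=
  ∑' k : ℕ, x ^ k / Real.Gamma (α * k + 1)

def CompletelyMonotoneOn (φ : ℝ → ℝ) : Prop :=
  ContDiffOn ℝ (⊤ : ℕ∞) φ (Set.Ioi 0) ∧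
    ∀ n : ℕ, ∀ x > (0 : ℝ), 0 ≤ (-1 : ℝ) ^ n * iteratedDerivWithin n φ (Set.Ioi 0) x

open MeasureTheory ProbabilityTheory

theorem Real.rpow_mul_exp_neg_le_Gamma {T y : ℝ} (hT : 0 < T) (hy : 0 ≤ y) :
    T ^ y * Real.exp (-T) ≤ Real.Gamma (y + 1) := by
  have hint : IntegrableOn (fun t : ℝ => Real.exp (-t) * t ^ (y + 1 - 1)) (Set.Ioi 0) :=
    Real.GammaIntegral_convergent (by linarith)
  rw [Real.Gamma_eq_integral (by linarith)]
  calc T ^ y * Real.exp (-T) = ∫ t in Set.Ioi T, T ^ y * Real.exp (-t) := by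
        rw [integral_const_mul, integral_exp_neg_Ioi]
    _ ≤ ∫ t in Set.Ioi T, Real.exp (-t) * t ^ (y + 1 - 1) := by
        refine setIntegral_mono_on ((integrableOn_exp_neg_Ioi T).const_mul _)
          (hint.mono_set (Set.Ioi_subset_Ioi hT.le)) measurableSet_Ioi fun t ht => ?_
        rw [add_sub_cancel_right, mul_comm]
        gcongr
        exact ht.le
    _ ≤ ∫ t in Set.Ioi 0, Real.exp (-t) * t ^ (y + 1 - 1) := by
        refine setIntegral_mono_set hint ?_ (Set.Ioi_subset_Ioi hT.le).eventuallyLE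
        filter_upwards [ae_restrict_mem measurableSet_Ioi] with t ht
        have : (0 : ℝ) < t := ht
        positivity

theorem summable_mittagLeffler {α : ℝ} (hα : 0 < α) (x : ℝ) :
    Summable fun k : ℕ => x ^ k / Real.Gamma (α * k + 1) := by
  set c : ℝ := 2 * |x| + 1 with hc
  have hc0 : 0 < c := by positivity
  have hT : 0 < c ^ (1 / α) := Real.rpow_pos_of_pos hc0 _
  have hq : |x| / c < 1 := by rw [div_lt_one hc0]; linarith [abs_nonneg x]
  refine Summable.of_norm_bounded
    (g := fun k : ℕ => Real.exp (c ^ (1 / α)) * (|x| / c) ^ k)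
    ((summable_geometric_of_lt_one (by positivity) hq).mul_left _) fun k => ?_
  have hk : 0 ≤ α * (k : ℝ) := by positivity
  have hG := Real.rpow_mul_exp_neg_le_Gamma hT hk
  have hpow : (c ^ (1 / α)) ^ (α * (k : ℝ)) = c ^ k := by
    rw [← Real.rpow_mul hc0.le, ← Real.rpow_natCast]
    congr 1
    field_simp
  rw [hpow] at hG
  have hG0 : 0 < Real.Gamma (α * k + 1) := Real.Gamma_pos_of_pos (by linarith)
  rw [norm_div, norm_pow, Real.norm_eq_abs, Real.norm_of_nonneg hG0.le, div_le_iff₀ hG0]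
  calc |x| ^ k = Real.exp (c ^ (1 / α)) * (|x| / c) ^ k *
        (c ^ k * Real.exp (-(c ^ (1 / α)))) := by
        rw [Real.exp_neg, div_pow]
        field_simp
    _ ≤ _ := by gcongr

section StableLaw

variable {μ : Measure ℝ} {α : ℝ}

/-- Negative moments of a one-sided stable law, by writing `Γ(r) u^(-r)` as a Mellin transform. -/
theorem lintegral_rpow_neg_of_laplace_stable [IsFiniteMeasure μ] (hα : 0 < α)
    (hpos : ∀ᵐ u ∂μ, 0 < u)
    (hlt : ∀ s > (0 : ℝ), ∫ u, Real.exp (-(s * u)) ∂μ = Real.exp (-(s ^ α)))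
    {r : ℝ} (hr : 0 < r) :
    ∫⁻ u, ENNReal.ofReal (u ^ (-r)) ∂μ =
      ENNReal.ofReal (Real.Gamma (r / α + 1) / Real.Gamma (r + 1)) := by
  have hΓ : 0 < Real.Gamma r := Real.Gamma_pos_of_pos hr
  have hmellin : ∀ u > (0 : ℝ), ENNReal.ofReal (u ^ (-r)) =
      ENNReal.ofReal (Real.Gamma r)⁻¹ *
        ∫⁻ s in Set.Ioi (0 : ℝ), ENNReal.ofReal (s ^ (r - 1) * Real.exp (-(u * s))) := by
    intro u hu
    have hval := Real.integral_rpow_mul_exp_neg_mul_Ioi hr hu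
    have hne : (1 / u) ^ r * Real.Gamma r ≠ 0 := by positivity
    have hint : Integrable (fun s : ℝ => s ^ (r - 1) * Real.exp (-(u * s)))
        (volume.restrict (Set.Ioi 0)) := by
      by_contra h
      rw [integral_undef h] at hval
      exact hne hval.symm
    rw [← ofReal_integral_eq_lintegral_ofReal hint, hval,
      ← ENNReal.ofReal_mul (inv_nonneg.2 hΓ.le)]
    · congr 1
      rw [one_div, Real.inv_rpow hu.le, Real.rpow_neg hu.le]
      field_simp
    · filter_upwards [ae_restrict_mem measurableSet_Ioi] with s hs
      have : (0 : ℝ) < s := hs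
      positivity
  have hlap : ∀ s > (0 : ℝ), ∫⁻ u, ENNReal.ofReal (Real.exp (-(u * s))) ∂μ =
      ENNReal.ofReal (Real.exp (-(s ^ α))) := by
    intro s hs
    have hint : Integrable (fun u : ℝ => Real.exp (-(s * u))) μ := by
      by_contra h
      have := hlt s hs
      rw [integral_undef h] at this
      exact (Real.exp_pos _).ne this
    rw [← hlt s hs, ofReal_integral_eq_lintegral_ofReal hint (ae_of_all _ fun _ => by positivity)]
    simp only [mul_comm]
  have hval := integral_rpow_mul_exp_neg_rpow hα (q := r - 1) (by linarith)
  have hne : 1 / α * Real.Gamma ((r - 1 + 1) / α) ≠ 0 := by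
    rw [sub_add_cancel]
    have := Real.Gamma_pos_of_pos (div_pos hr hα)
    positivity
  have hint : Integrable (fun s : ℝ => s ^ (r - 1) * Real.exp (-(s ^ α)))
      (volume.restrict (Set.Ioi 0)) := by
    by_contra h
    rw [integral_undef h] at hval
    exact hne hval.symm
  calc ∫⁻ u, ENNReal.ofReal (u ^ (-r)) ∂μ
      = ∫⁻ u, ENNReal.ofReal (Real.Gamma r)⁻¹ * (∫⁻ s in Set.Ioi (0 : ℝ),
          ENNReal.ofReal (s ^ (r - 1) * Real.exp (-(u * s)))) ∂μ :=
        lintegral_congr_ae (hpos.mono hmellin)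
    _ = ENNReal.ofReal (Real.Gamma r)⁻¹ * ∫⁻ u, (∫⁻ s in Set.Ioi (0 : ℝ),
          ENNReal.ofReal (s ^ (r - 1) * Real.exp (-(u * s)))) ∂μ :=
        lintegral_const_mul' _ _ ENNReal.ofReal_ne_top
    _ = ENNReal.ofReal (Real.Gamma r)⁻¹ * ∫⁻ s in Set.Ioi (0 : ℝ), (∫⁻ u,
          ENNReal.ofReal (s ^ (r - 1) * Real.exp (-(u * s))) ∂μ) := by
        rw [lintegral_lintegral_swap]
        exact (by fun_prop : Measurable fun p : ℝ × ℝ =>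
          ENNReal.ofReal (p.2 ^ (r - 1) * Real.exp (-(p.1 * p.2)))).aemeasurable
    _ = ENNReal.ofReal (Real.Gamma r)⁻¹ * ∫⁻ s in Set.Ioi (0 : ℝ),
          ENNReal.ofReal (s ^ (r - 1) * Real.exp (-(s ^ α))) := by
        congr 1
        refine setLIntegral_congr_fun measurableSet_Ioi fun s hs => ?_
        have hs0 : 0 ≤ s ^ (r - 1) := Real.rpow_nonneg (le_of_lt hs) _
        simp only [ENNReal.ofReal_mul hs0]
        rw [lintegral_const_mul' _ _ ENNReal.ofReal_ne_top, hlap s hs]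
    _ = ENNReal.ofReal (Real.Gamma (r / α + 1) / Real.Gamma (r + 1)) := by
        rw [← ofReal_integral_eq_lintegral_ofReal hint, hval,
          ← ENNReal.ofReal_mul (inv_nonneg.2 hΓ.le), sub_add_cancel,
          Real.Gamma_add_one hr.ne', Real.Gamma_add_one (div_pos hr hα).ne']
        · congr 1
          field_simp
        · filter_upwards [ae_restrict_mem measurableSet_Ioi] with s hs
          have : (0 : ℝ) < s := hs
          positivity

theorem integrable_and_integral_rpow_neg_pow_of_laplace_stable [IsProbabilityMeasure μ] (hα : 0 < α)
    (hpos : ∀ᵐ u ∂μ, 0 < u)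
    (hlt : ∀ s > (0 : ℝ), ∫ u, Real.exp (-(s * u)) ∂μ = Real.exp (-(s ^ α))) (k : ℕ) :
    Integrable (fun u : ℝ => (u ^ (-α)) ^ k) μ ∧
      ∫ u, (u ^ (-α)) ^ k ∂μ = k.factorial / Real.Gamma (α * k + 1) := by
  rcases k.eq_zero_or_pos with rfl | hk
  · simp
  have hk0 : (0 : ℝ) < k := by exact_mod_cast hk
  have hnn : 0 ≤ᵐ[μ] fun u : ℝ => (u ^ (-α)) ^ k := by
    filter_upwards [hpos] with u hu
    positivity
  have hmeas : AEStronglyMeasurable (fun u : ℝ => (u ^ (-α)) ^ k) μ :=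
    Measurable.aestronglyMeasurable (by fun_prop)
  have hmom : ∫⁻ u, ENNReal.ofReal ((u ^ (-α)) ^ k) ∂μ =
      ENNReal.ofReal (k.factorial / Real.Gamma (α * k + 1)) := by
    have h := lintegral_rpow_neg_of_laplace_stable hα hpos hlt (mul_pos hα hk0)
    rw [mul_div_cancel_left₀ _ hα.ne', Real.Gamma_nat_eq_factorial] at h
    rw [← h]
    refine lintegral_congr_ae (hpos.mono fun u hu => ?_)
    simp only [← Real.rpow_natCast, ← Real.rpow_mul hu.le, neg_mul]
  refine ⟨(lintegral_ofReal_ne_top_iff_integrable hmeas hnn).1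
    (hmom ▸ ENNReal.ofReal_ne_top), ?_⟩
  rw [integral_eq_lintegral_of_nonneg_ae hnn hmeas, hmom, ENNReal.toReal_ofReal]
  have := Real.Gamma_pos_of_pos (show 0 < α * k + 1 by positivity)
  positivity

theorem integrable_and_integral_exp_rpow_neg_of_laplace_stable [IsProbabilityMeasure μ] (hα : 0 < α)
    (hpos : ∀ᵐ u ∂μ, 0 < u)
    (hlt : ∀ s > (0 : ℝ), ∫ u, Real.exp (-(s * u)) ∂μ = Real.exp (-(s ^ α))) (x : ℝ) :
    Integrable (fun u : ℝ => Real.exp (x * u ^ (-α))) μ ∧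
      ∫ u, Real.exp (x * u ^ (-α)) ∂μ = mittagLeffler α x := by
  have hmom := integrable_and_integral_rpow_neg_pow_of_laplace_stable hα hpos hlt
  have hexp : ∀ y : ℝ, HasSum (fun k : ℕ => y ^ k / k.factorial) (Real.exp y) := fun y => by
    rw [Real.exp_eq_exp_ℝ]
    exact NormedSpace.expSeries_div_hasSum_exp y
  have hterm : ∀ (y : ℝ) (k : ℕ), (fun u : ℝ => (y * u ^ (-α)) ^ k / k.factorial) =
      fun u => y ^ k / k.factorial * (u ^ (-α)) ^ k := fun y k => by
    ext u; rw [mul_pow]; ring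
  have hF_int : ∀ (y : ℝ) (k : ℕ),
      Integrable (fun u : ℝ => (y * u ^ (-α)) ^ k / k.factorial) μ := fun y k => by
    rw [hterm]; exact (hmom k).1.const_mul _
  have hF_val : ∀ (y : ℝ) (k : ℕ), ∫ u, (y * u ^ (-α)) ^ k / k.factorial ∂μ =
      y ^ k / Real.Gamma (α * k + 1) := fun y k => by
    rw [hterm, integral_const_mul, (hmom k).2]
    field_simp
  have hF_norm : ∀ (y : ℝ) (k : ℕ), ∫ u, ‖(y * u ^ (-α)) ^ k / k.factorial‖ ∂μ =
      |y| ^ k / Real.Gamma (α * k + 1) := fun y k => by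
    rw [← hF_val]
    refine integral_congr_ae (hpos.mono fun u hu => ?_)
    have : 0 < u ^ (-α) := Real.rpow_pos_of_pos hu _
    simp [abs_of_pos this]
  have hval : ∀ y : ℝ, ∫ u, Real.exp (y * u ^ (-α)) ∂μ = mittagLeffler α y := fun y => by
    have hsum : Summable fun k : ℕ => ∫ u, ‖(y * u ^ (-α)) ^ k / k.factorial‖ ∂μ := by
      simpa only [hF_norm] using summable_mittagLeffler hα |y|
    have := (hasSum_integral_of_summable_integral_norm (hF_int y) hsum).tsum_eq
    simp only [hF_val, (hexp _).tsum_eq] at this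
    exact this.symm
  have hML_pos : 0 < mittagLeffler α |x| := by
    have hnn : ∀ k : ℕ, 0 ≤ |x| ^ k / Real.Gamma (α * k + 1) := fun k =>
      div_nonneg (by positivity) (Real.Gamma_pos_of_pos (by positivity)).le
    exact (summable_mittagLeffler hα |x|).tsum_pos hnn 0 (by simp)
  have hint : Integrable (fun u : ℝ => Real.exp (|x| * u ^ (-α))) μ := by
    by_contra h
    have := hval |x|
    rw [integral_undef h] at this
    exact hML_pos.ne this
  refine ⟨hint.mono' (Measurable.aestronglyMeasurable (by fun_prop)) ?_, hval x⟩
  filter_upwards [hpos] with u hu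
  rw [Real.norm_of_nonneg (Real.exp_pos _).le]
  have : 0 < u ^ (-α) := Real.rpow_pos_of_pos hu _
  gcongr
  exact le_abs_self x

theorem completelyMonotoneOn_mittagLeffler_neg [IsProbabilityMeasure μ] (hα : 0 < α)
    (hpos : ∀ᵐ u ∂μ, 0 < u)
    (hlt : ∀ s > (0 : ℝ), ∫ u, Real.exp (-(s * u)) ∂μ = Real.exp (-(s ^ α))) :
    CompletelyMonotoneOn fun x : ℝ => mittagLeffler α (-x) := by
  have hexp := integrable_and_integral_exp_rpow_neg_of_laplace_stable hα hpos hlt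
  have hset : integrableExpSet (fun u : ℝ => -u ^ (-α)) μ = Set.univ := by
    refine Set.eq_univ_of_forall fun t => ?_
    simpa [integrableExpSet] using (hexp (-t)).1
  have hmgf : (fun x : ℝ => mittagLeffler α (-x)) = mgf (fun u : ℝ => -u ^ (-α)) μ := by
    ext x
    simp [mgf, ← (hexp (-x)).2]
  have hmem : ∀ t, t ∈ interior (integrableExpSet (fun u : ℝ => -u ^ (-α)) μ) := by simp [hset]
  have hsmooth : ContDiff ℝ (⊤ : ℕ∞) (mgf (fun u : ℝ => -u ^ (-α)) μ) :=
    contDiff_iff_contDiffAt.2 fun t => (analyticAt_mgf (hmem t)).contDiffAt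
  rw [hmgf]
  refine ⟨hsmooth.contDiffOn, fun n x hx => ?_⟩
  rw [iteratedDerivWithin_of_isOpen isOpen_Ioi hx, iteratedDeriv_mgf (hmem x),
    ← integral_const_mul]
  refine integral_nonneg_of_ae (hpos.mono fun u hu => ?_)
  have : 0 < u ^ (-α) := Real.rpow_pos_of_pos hu _
  simp only [Pi.zero_apply, ← mul_assoc, ← mul_pow, neg_one_mul, neg_neg]
  positivity

end StableLaw

theorem mittagLeffler_laplace_pollard (α : ℝ) (hα : 0 < α) (hα1 : α < 1) (f : ℝ → ℝ)
    (hf_pos : ∀ x > (0 : ℝ), 0 < f x)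
    (hf_prob : ∫ x in Set.Ioi (0 : ℝ), f x = 1)
    (hf_lt : ∀ s > (0 : ℝ),
      ∫ t in Set.Ioi (0 : ℝ), Real.exp (-(s * t)) * f t = Real.exp (-(s ^ α))) :
    (∀ x ≥ (0 : ℝ),
      mittagLeffler α (-x) =
        ∫ t in Set.Ioi (0 : ℝ),
          Real.exp (-(x * t)) * ((1 / α) * f (t ^ (-(1 / α))) * t ^ (-(1 / α) - 1))) ∧
      CompletelyMonotoneOn (fun x : ℝ => mittagLeffler α (-x)) := by
  have hf_int : Integrable f (volume.restrict (Set.Ioi 0)) := by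
    by_contra h
    rw [integral_undef h] at hf_prob
    exact zero_ne_one hf_prob
  have hf_ae : ∀ᵐ u ∂volume.restrict (Set.Ioi (0 : ℝ)), 0 ≤ f u := by
    filter_upwards [ae_restrict_mem measurableSet_Ioi] with u hu using (hf_pos u hu).le
  set μ : Measure ℝ := (volume.restrict (Set.Ioi 0)).withDensity fun u => ENNReal.ofReal (f u)
    with hμ
  have hμ_int : ∀ g : ℝ → ℝ, ∫ u, g u ∂μ = ∫ u in Set.Ioi (0 : ℝ), g u * f u := by
    intro g
    rw [hμ, integral_withDensity_eq_integral_toReal_smul₀ hf_int.aemeasurable.ennreal_ofReal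
      (ae_of_all _ fun _ => ENNReal.ofReal_lt_top)]
    refine integral_congr_ae (hf_ae.mono fun u hu => ?_)
    simp only [ENNReal.toReal_ofReal hu, smul_eq_mul, mul_comm]
  have hμ_prob : IsProbabilityMeasure μ := ⟨by
    rw [hμ, withDensity_apply _ MeasurableSet.univ, Measure.restrict_univ,
      ← ofReal_integral_eq_lintegral_ofReal hf_int hf_ae, hf_prob, ENNReal.ofReal_one]⟩
  have hμ_pos : ∀ᵐ u ∂μ, 0 < u :=
    (withDensity_absolutelyContinuous _ _).ae_le (ae_restrict_mem measurableSet_Ioi)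
  have hμ_lt : ∀ s > (0 : ℝ), ∫ u, Real.exp (-(s * u)) ∂μ = Real.exp (-(s ^ α)) :=
    fun s hs => (hμ_int _).trans (hf_lt s hs)
  refine ⟨fun x _ => ?_, completelyMonotoneOn_mittagLeffler_neg hα hμ_pos hμ_lt⟩
  rw [← (integrable_and_integral_exp_rpow_neg_of_laplace_stable hα hμ_pos hμ_lt (-x)).2, hμ_int,
    ← integral_comp_rpow_Ioi _ (neg_ne_zero.2 (one_div_pos.2 hα).ne')]
  refine setIntegral_congr_fun measurableSet_Ioi fun t ht => ?_
  have hcancel : (t ^ (-(1 / α))) ^ (-α) = t := by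
    rw [← Real.rpow_mul (le_of_lt ht), neg_mul_neg, one_div_mul_cancel hα.ne', Real.rpow_one]
  simp only [hcancel, abs_neg, abs_of_pos (one_div_pos.2 hα), smul_eq_mul, neg_mul]
  ring
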